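/- arXiv:2306.06375 — 5 statements merged into one kernel-verified Lean document; each statement's English description precedes it below -/
import Mathlib

section
/- Let f : ℝ^d → ℝ be differentiable and L-smooth for some L > 0, and let M ∈ ℝ^{d×d} be a symmetric positive semidefinite matrix with M ≺ L·I_d (so that L_M := L·I_d − M is positive definite, hence invertible), such that x ↦ f(x) − (1/2)·xᵀMx is convex on ℝ^d. Then for all x, y ∈ ℝ^d, setting u = ∇f(x) and v = ∇f(y), the quadratic form [x−y; u−v]ᵀ S [x−y; u−v] ≥ 0, where S is the 2d×2d block matrix S = [[−2·L·L_M^{−1}·M, L_M^{−1}·(M + L·I_d)], [L_M^{−1}·(M + L·I_d), −2·L_M^{−1}]]. -/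
open Matrix Finset

/-- The `P`-norm `‖v‖_P = √(vᵀ P v)`. -/
noncomputable def Pnorm {ι : Type*} [Fintype ι] (P : Matrix ι ι ℝ) (v : ι → ℝ) : ℝ :=
  Real.sqrt (v ⬝ᵥ P.mulVec v)

/-- The Euclidean norm of a finitely supported real vector. -/
noncomputable def vnorm {ι : Type*} [Fintype ι] (v : ι → ℝ) : ℝ :=
  Real.sqrt (v ⬝ᵥ v)

/-- Smallest eigenvalue of a hermitian (real symmetric) matrix. -/
noncomputable def lamMin {ι : Type*} [Fintype ι] [DecidableEq ι]
    (P : Matrix ι ι ℝ) (hP : P.IsHermitian) : ℝ := ⨅ i, hP.eigenvalues i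

/-- Largest eigenvalue of a hermitian (real symmetric) matrix. -/
noncomputable def lamMax {ι : Type*} [Fintype ι] [DecidableEq ι]
    (P : Matrix ι ι ℝ) (hP : P.IsHermitian) : ℝ := ⨆ i, hP.eigenvalues i

section CoCoercivity

variable {E : Type*} [NormedAddCommGroup E] [InnerProductSpace ℝ E] [CompleteSpace E]

theorem hasDerivAt_comp_add_smul_of_differentiable {f : E → ℝ} (hf : Differentiable ℝ f)
    (a k : E) (t : ℝ) :
    HasDerivAt (fun s : ℝ => f (a + s • k)) (inner ℝ (gradient f (a + t • k)) k) t := by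
  have hg := (hf (a + t • k)).hasGradientAt.hasFDerivAt
  have hl : HasDerivAt (fun s : ℝ => a + s • k) k t := by
    simpa using ((hasDerivAt_id t).smul_const k).const_add a
  simpa [Function.comp_def] using hg.comp_hasDerivAt t hl

/-- The descent lemma for a function with `L`-Lipschitz gradient. -/
theorem le_add_inner_gradient_add_sq {f : E → ℝ} (hf : Differentiable ℝ f) {L : ℝ}
    (hL : ∀ x y : E, ‖gradient f x - gradient f y‖ ≤ L * ‖x - y‖) (a k : E) :
    f (a + k) ≤ f a + inner ℝ (gradient f a) k + L / 2 * ‖k‖ ^ 2 := by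
  have hd : ∀ t : ℝ, HasDerivAt
      (fun s : ℝ => f (a + s • k) - s * inner ℝ (gradient f a) k - L / 2 * ‖k‖ ^ 2 * s ^ 2)
      (inner ℝ (gradient f (a + t • k)) k - inner ℝ (gradient f a) k - L * ‖k‖ ^ 2 * t) t := by
    intro t
    have h := ((hasDerivAt_comp_add_smul_of_differentiable hf a k t).sub
      ((hasDerivAt_id t).mul_const (inner ℝ (gradient f a) k))).sub
      ((hasDerivAt_pow 2 t).const_mul (L / 2 * ‖k‖ ^ 2))
    refine h.congr_deriv ?_
    push_cast
    ring
  have hanti := antitoneOn_of_deriv_nonpos (convex_Icc (0 : ℝ) 1)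
    (fun t _ => (hd t).continuousAt.continuousWithinAt)
    (fun t _ => (hd t).differentiableAt.differentiableWithinAt) (by
      intro t ht
      rw [interior_Icc] at ht
      rw [(hd t).deriv, ← inner_sub_left]
      have h1 := real_inner_le_norm (gradient f (a + t • k) - gradient f a) k
      have h2 := hL (a + t • k) a
      rw [add_sub_cancel_left, norm_smul, Real.norm_of_nonneg ht.1.le] at h2
      nlinarith [mul_le_mul_of_nonneg_right h2 (norm_nonneg k)])
  have h := hanti (Set.left_mem_Icc.2 zero_le_one) (Set.right_mem_Icc.2 zero_le_one) zero_le_one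
  simp only [one_smul, zero_smul, add_zero] at h
  linarith

/-- The first-order lower bound for a function `f` such that `f - ⟪·, T ·⟫ / 2` is convex. -/
theorem add_inner_gradient_add_le_of_convexOn_sub {f : E → ℝ} (hf : Differentiable ℝ f)
    {T : E →ₗ[ℝ] E} (hT : T.IsSymmetric)
    (hconv : ConvexOn ℝ Set.univ fun x => f x - 1 / 2 * inner ℝ x (T x)) (a k : E) :
    f a + inner ℝ (gradient f a) k + 1 / 2 * inner ℝ k (T k) ≤ f (a + k) := by
  have hquad : ∀ s : ℝ, inner ℝ (a + s • k) (T (a + s • k)) =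
      inner ℝ a (T a) + 2 * s * inner ℝ a (T k) + s ^ 2 * inner ℝ k (T k) := by
    intro s
    have h : inner ℝ k (T a) = inner ℝ a (T k) := by rw [← hT, real_inner_comm]
    simp only [map_add, map_smul, inner_add_left, inner_add_right, inner_smul_left,
      inner_smul_right, h, RCLike.conj_to_real]
    ring
  have hline : ConvexOn ℝ Set.univ fun s : ℝ =>
      f (a + s • k) - 1 / 2 * inner ℝ (a + s • k) (T (a + s • k)) := by
    have h := hconv.comp_affineMap (AffineMap.lineMap a (a + k))
    simpa [Function.comp_def, AffineMap.lineMap_apply, add_comm] using h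
  simp only [hquad] at hline
  have hd : HasDerivAt (fun s : ℝ => f (a + s • k) - 1 / 2 *
      (inner ℝ a (T a) + 2 * s * inner ℝ a (T k) + s ^ 2 * inner ℝ k (T k)))
      (inner ℝ (gradient f a) k - inner ℝ a (T k)) 0 := by
    have h := (hasDerivAt_comp_add_smul_of_differentiable hf a k 0).sub
      ((((((hasDerivAt_id (0 : ℝ)).const_mul 2).mul_const (inner ℝ a (T k))).const_add
        (inner ℝ a (T a))).add ((hasDerivAt_pow 2 (0 : ℝ)).mul_const
          (inner ℝ k (T k)))).const_mul (1 / 2))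
    refine h.congr_deriv ?_
    simp
  have h := hline.le_slope_of_hasDerivAt (Set.mem_univ 0) (Set.mem_univ 1) one_pos hd
  simp only [slope_def_field, one_smul, zero_smul, add_zero] at h
  linarith

theorem inner_le_inner_of_convexOn_sub_of_lipschitz_gradient {f : E → ℝ}
    (hf : Differentiable ℝ f) {L : ℝ}
    (hL : ∀ x y : E, ‖gradient f x - gradient f y‖ ≤ L * ‖x - y‖)
    {T : E →ₗ[ℝ] E} (hT : T.IsSymmetric)
    (hconv : ConvexOn ℝ Set.univ fun x => f x - 1 / 2 * inner ℝ x (T x)) (x y r : E)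
    (hr : L • r - T r = gradient f x - gradient f y - T (x - y)) :
    inner ℝ (gradient f x - gradient f y - T (x - y)) r ≤
      inner ℝ (gradient f x - gradient f y - T (x - y)) (x - y) := by
  have hu : gradient f x = gradient f y + T (x - y) + L • r - T r := by
    rw [add_sub_assoc, hr]; abel
  have h1 := le_add_inner_gradient_add_sq hf hL x (-r)
  have h2 := add_inner_gradient_add_le_of_convexOn_sub hf hT hconv y (x - y - r)
  have h3 := le_add_inner_gradient_add_sq hf hL y r
  have h4 := add_inner_gradient_add_le_of_convexOn_sub hf hT hconv x (r - (x - y))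
  rw [show y + (x - y - r) = x + -r by abel] at h2
  rw [show x + (r - (x - y)) = y + r by abel] at h4
  rw [← hr]
  rw [hu] at h1 h4
  generalize x - y = z at *
  have s1 : inner ℝ (T r) z = inner ℝ r (T z) := hT r z
  have s2 : inner ℝ (T z) r = inner ℝ r (T z) := real_inner_comm _ _
  have s3 : inner ℝ z (T r) = inner ℝ r (T z) := by rw [← hT, s2]
  have s4 : inner ℝ (T r) r = inner ℝ r (T r) := hT r r
  have s5 : inner ℝ (T z) z = inner ℝ z (T z) := hT z z
  simp only [map_sub, inner_add_left, inner_sub_left, inner_sub_right, inner_neg_right,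
    inner_smul_left, RCLike.conj_to_real, norm_neg, s1, s2, s3, s4, s5,
    ← real_inner_self_eq_norm_sq] at *
  linarith

end CoCoercivity

/-- The quadratic form of the co-coercivity block matrix in terms of `w = g - M z`. -/
theorem sumElim_dotProduct_fromBlocks_mulVec {n : Type*} [Fintype n] [DecidableEq n] (L : ℝ)
    {M : Matrix n n ℝ} (hM : M.IsSymm) (hdet : IsUnit (L • (1 : Matrix n n ℝ) - M).det)
    (z g : n → ℝ) :
    (Sum.elim z g) ⬝ᵥ
        (Matrix.fromBlocks
          (-(2 * L) • ((L • 1 - M)⁻¹ * M))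
          ((L • 1 - M)⁻¹ * (M + L • 1))
          ((L • 1 - M)⁻¹ * (M + L • 1))
          (-(2 : ℝ) • (L • 1 - M)⁻¹)).mulVec (Sum.elim z g) =
      2 * ((g - M *ᵥ z) ⬝ᵥ z - (g - M *ᵥ z) ⬝ᵥ (L • 1 - M)⁻¹ *ᵥ (g - M *ᵥ z)) := by
  set P := (L • (1 : Matrix n n ℝ) - M)⁻¹ with hP
  have hPs : Pᵀ = P := by
    rw [hP, transpose_nonsing_inv, transpose_sub, transpose_smul, transpose_one, hM.eq]
  have hPM : P * M = L • P - 1 := by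
    have h := nonsing_inv_mul _ hdet
    rw [← hP, mul_sub, mul_smul_comm, mul_one] at h
    rw [← h]; abel
  have hMs : ∀ a b : n → ℝ, (M *ᵥ a) ⬝ᵥ b = a ⬝ᵥ M *ᵥ b := fun a b => by
    rw [dotProduct_mulVec, ← mulVec_transpose, hM.eq]
  have hPsymm : ∀ a b : n → ℝ, a ⬝ᵥ P *ᵥ b = b ⬝ᵥ P *ᵥ a := fun a b => by
    rw [dotProduct_mulVec, ← mulVec_transpose, hPs, dotProduct_comm]
  have hPMv : ∀ a : n → ℝ, P *ᵥ M *ᵥ a = L • P *ᵥ a - a := fun a => by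
    rw [mulVec_mulVec, hPM, sub_mulVec, smul_mulVec, one_mulVec]
  have hMP : ∀ a b : n → ℝ, (M *ᵥ a) ⬝ᵥ P *ᵥ b = L * (a ⬝ᵥ P *ᵥ b) - a ⬝ᵥ b := fun a b => by
    rw [hPsymm, hPMv, dotProduct_sub, dotProduct_smul, hPsymm, dotProduct_comm b a, smul_eq_mul]
  rw [fromBlocks_mulVec, dotProduct_comm]
  simp only [mul_add, hPM, mul_smul_comm, mul_one, Sum.elim_comp_inl, Sum.elim_comp_inr,
    sumElim_dotProduct_sumElim, add_mulVec, sub_mulVec, smul_mulVec, one_mulVec, smul_sub,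
    mulVec_sub, add_dotProduct, sub_dotProduct, smul_dotProduct, dotProduct_sub,
    dotProduct_smul, hPMv, hMP, smul_eq_mul, dotProduct_comm (P *ᵥ _), hPsymm g z,
    dotProduct_comm g z]
  ring

/-- **Lemma 1 (generalized co-coercivity).** If `f` is differentiable, `L`-smooth and
`M`-convex with `M` symmetric PSD and `L•I - M` positive definite, then for all `x, y`,
setting `u = ∇f(x)`, `v = ∇f(y)`, the quadratic form `[x-y; u-v]ᵀ S [x-y; u-v] ≥ 0` where
`S = [[-2L·L_M⁻¹M, L_M⁻¹(M+L·I)], [L_M⁻¹(M+L·I), -2·L_M⁻¹]]` and `L_M = L•I - M`. -/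
theorem generalized_cocoercivity {d : ℕ} (L : ℝ) (hL : 0 < L)
    (M : Matrix (Fin d) (Fin d) ℝ) (hM : M.PosSemidef)
    (hLM : (L • (1 : Matrix (Fin d) (Fin d) ℝ) - M).PosDef)
    (f : EuclideanSpace ℝ (Fin d) → ℝ)
    (hdiff : Differentiable ℝ f)
    (hsmooth : ∀ x y : EuclideanSpace ℝ (Fin d),
      ‖gradient f x - gradient f y‖ ≤ L * ‖x - y‖)
    (hconv : ConvexOn ℝ Set.univ
      (fun x : EuclideanSpace ℝ (Fin d) =>
        f x - (1 / 2) * ((fun i => x i) ⬝ᵥ M.mulVec fun i => x i)))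
    (x y : EuclideanSpace ℝ (Fin d)) :
    0 ≤ (Sum.elim (fun i => x i - y i)
          (fun i => gradient f x i - gradient f y i)) ⬝ᵥ
        (Matrix.fromBlocks
          (-(2 * L) • ((L • 1 - M)⁻¹ * M))
          ((L • 1 - M)⁻¹ * (M + L • 1))
          ((L • 1 - M)⁻¹ * (M + L • 1))
          (-(2 : ℝ) • (L • 1 - M)⁻¹)).mulVec
        (Sum.elim (fun i => x i - y i)
          (fun i => gradient f x i - gradient f y i)) := by
  have hMs : M.IsSymm := by simpa using hM.isHermitian
  have hdet : IsUnit (L • (1 : Matrix (Fin d) (Fin d) ℝ) - M).det := hLM.det_pos.ne'.isUnit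
  have hT : (toEuclideanLin M).IsSymmetric := isSymmetric_toEuclideanLin_iff.2 hM.isHermitian
  refine le_of_le_of_eq ?_ (sumElim_dotProduct_fromBlocks_mulVec L hMs hdet
    (x - y).ofLp (gradient f x - gradient f y).ofLp).symm
  set w : Fin d → ℝ := (gradient f x - gradient f y).ofLp - M *ᵥ (x - y).ofLp with hw
  have hwE : gradient f x - gradient f y - toEuclideanLin M (x - y) = WithLp.toLp 2 w := by
    ext i
    simp [hw, mulVec_sub]
  have hinv : (L • (1 : Matrix (Fin d) (Fin d) ℝ) - M) *ᵥ (L • 1 - M)⁻¹ *ᵥ w = w := by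
    rw [mulVec_mulVec, mul_nonsing_inv _ hdet, one_mulVec]
  have h := inner_le_inner_of_convexOn_sub_of_lipschitz_gradient hdiff hsmooth hT
    (by simpa [EuclideanSpace.inner_eq_star_dotProduct, dotProduct_comm] using hconv) x y
    (WithLp.toLp 2 ((L • 1 - M)⁻¹ *ᵥ w)) (by
      rw [hwE]
      ext i
      simpa [sub_mulVec, smul_mulVec, -mulVec_mulVec] using congrFun hinv i)
  rw [hwE, EuclideanSpace.inner_eq_star_dotProduct, EuclideanSpace.inner_eq_star_dotProduct,
    star_trivial, dotProduct_comm _ w, dotProduct_comm _ w] at h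
  linarith
end

section
/- Let H^{(1)}, H^{(2)}, H^{(3)}, H^{(4)}, H^{(5)} ∈ ℝ^{nd×nd} and H^{(6)}, H^{(7)}, H^{(8)} ∈ ℝ^{d×nd} satisfy H^{(6)}H^{(1)} + H^{(7)}H^{(3)} = H^{(6)}, H^{(6)}H^{(2)} + H^{(7)}H^{(4)} = H^{(7)}, and H^{(7)}H^{(5)} = H^{(8)}. Let sequences x^k, s^k, g^k ∈ ℝ^{nd} (k ≥ 0) satisfy the updates x^k = H^{(1)}x^{k−1} + H^{(2)}s^{k−1} and s^k = H^{(3)}x^{k−1} + H^{(4)}s^{k−1} + H^{(5)}(g^{k−1} − g^k) for all k ≥ 1, together with the initialization H^{(6)}x^0 + H^{(7)}s^0 + H^{(8)}g^0 = 0. Then H^{(6)}x^k + H^{(7)}s^k + H^{(8)}g^k = 0 for all k ≥ 0. -/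
open Matrix Finset

/-- **Invariance of the GGT initialization constraint (eq. (12), Appendix A).**
If the parameter matrices satisfy the compatibility conditions (11) and the sequences
follow the GGT linear recursions with the initialization constraint (10), then the
constraint `H⁽⁶⁾x^k + H⁽⁷⁾s^k + H⁽⁸⁾g^k = 0` holds for all `k`. -/
theorem ggt_initialization_invariance {n d : ℕ}
    (H1 H2 H3 H4 H5 : Matrix (Fin (n * d)) (Fin (n * d)) ℝ)
    (H6 H7 H8 : Matrix (Fin d) (Fin (n * d)) ℝ)
    (hC1 : H6 * H1 + H7 * H3 = H6)
    (hC2 : H6 * H2 + H7 * H4 = H7)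
    (hC3 : H7 * H5 = H8)
    (x s g : ℕ → Fin (n * d) → ℝ)
    (hx : ∀ k, x (k + 1) = H1.mulVec (x k) + H2.mulVec (s k))
    (hs : ∀ k, s (k + 1) = H3.mulVec (x k) + H4.mulVec (s k)
      + H5.mulVec (g k - g (k + 1)))
    (hinit : H6.mulVec (x 0) + H7.mulVec (s 0) + H8.mulVec (g 0) = 0) :
    ∀ k, H6.mulVec (x k) + H7.mulVec (s k) + H8.mulVec (g k) = 0 := by
  intro k
  induction k with
  | zero => exact hinit
  | succ k ih =>
    have h1 := congrArg (·.mulVec (x k)) hC1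
    have h2 := congrArg (·.mulVec (s k)) hC2
    subst hC3
    simp only [add_mulVec, ← mulVec_mulVec] at h1 h2 ih ⊢
    rw [← h1, ← h2] at ih
    rw [hx, hs, ← ih]
    simp only [mulVec_add, mulVec_sub]
    abel
end

section
/- Let P ∈ ℝ^{N×N} be symmetric positive definite, ρ ∈ (0,1), σ ≥ 0, and let z^k, z^{k,⋆} ∈ ℝ^N (k ≥ 1) be sequences satisfying ‖z^{k+1} − z^{k,⋆}‖_P ≤ ρ·‖z^k − z^{k,⋆}‖_P for all k ≥ 1 and ‖z^{k,⋆} − z^{k−1,⋆}‖_P ≤ σ for all k ≥ 2. Then for all k ≥ 1, ‖z^{k+1} − z^{k,⋆}‖_P ≤ ρ^k·‖z^1 − z^{1,⋆}‖_P + σρ(1 − ρ^{k−1})/(1 − ρ). -/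
open Matrix Finset

/-- The `P`-norm is the Euclidean norm of the image under a square root factor of `P`. -/
lemma Pnorm_conjTranspose_mul_self {m n : Type*} [Fintype m] [Fintype n]
    (B : Matrix m n ℝ) (v : n → ℝ) :
    Pnorm (Bᴴ * B) v = ‖WithLp.toLp 2 (B *ᵥ v)‖ := by
  rw [Pnorm, EuclideanSpace.norm_eq, ← mulVec_mulVec, dotProduct_mulVec,
    conjTranspose_eq_transpose_of_trivial, vecMul_transpose]
  simp [dotProduct, pow_two]

open scoped MatrixOrder Matrix.Norms.L2Operator in
/-- Triangle inequality for the `P`-norm, in difference form. -/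
lemma Pnorm_sub_le {ι : Type*} [Fintype ι] {P : Matrix ι ι ℝ}
    (hP : P.PosSemidef) (u v : ι → ℝ) : Pnorm P (u - v) ≤ Pnorm P u + Pnorm P v := by
  classical
  obtain ⟨B, rfl⟩ := CStarAlgebra.nonneg_iff_eq_star_mul_self.mp hP.nonneg
  simp only [star_eq_conjTranspose, Pnorm_conjTranspose_mul_self, mulVec_sub, WithLp.toLp_sub]
  exact norm_sub_le _ _

/-- **Corollary 1 (P-norm form, eq. (37)).** Under the contraction and bounded-variation
hypotheses, `‖z^{k+1} - z^{k,⋆}‖_P ≤ ρ^k ‖z^1 - z^{1,⋆}‖_P + σρ(1 - ρ^{k-1})/(1 - ρ)`. -/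
theorem tracking_bound_Pnorm {N : ℕ}
    (P : Matrix (Fin N) (Fin N) ℝ) (hP : P.PosDef)
    (ρ σ : ℝ) (hρ0 : 0 < ρ) (hρ1 : ρ < 1) (hσ : 0 ≤ σ)
    (z zs : ℕ → Fin N → ℝ)
    (hcontract : ∀ k ≥ 1, Pnorm P (z (k + 1) - zs k) ≤ ρ * Pnorm P (z k - zs k))
    (hvar : ∀ k ≥ 2, Pnorm P (zs k - zs (k - 1)) ≤ σ) :
    ∀ k ≥ 1, Pnorm P (z (k + 1) - zs k) ≤
      ρ ^ k * Pnorm P (z 1 - zs 1) + σ * ρ * (1 - ρ ^ (k - 1)) / (1 - ρ) := by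
  intro k hk
  have hρ : 1 - ρ ≠ 0 := by linarith
  induction k, hk using Nat.le_induction with
  | base => simpa using hcontract 1 le_rfl
  | succ k hk ih =>
    obtain ⟨j, rfl⟩ := Nat.exists_eq_add_of_le' hk
    have htri : Pnorm P (z (j + 1 + 1) - zs (j + 1 + 1)) ≤
        Pnorm P (z (j + 1 + 1) - zs (j + 1)) + Pnorm P (zs (j + 1 + 1) - zs (j + 1)) := by
      simpa using Pnorm_sub_le hP.posSemidef (z (j + 1 + 1) - zs (j + 1))
        (zs (j + 1 + 1) - zs (j + 1))
    have hv : Pnorm P (zs (j + 1 + 1) - zs (j + 1)) ≤ σ := hvar (j + 1 + 1) (by omega)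
    calc Pnorm P (z (j + 1 + 1 + 1) - zs (j + 1 + 1))
        ≤ ρ * Pnorm P (z (j + 1 + 1) - zs (j + 1 + 1)) := hcontract _ (by omega)
      _ ≤ ρ * (ρ ^ (j + 1) * Pnorm P (z 1 - zs 1) +
            σ * ρ * (1 - ρ ^ (j + 1 - 1)) / (1 - ρ) + σ) := by
          gcongr
          linarith
      _ = _ := by
          simp only [Nat.add_sub_cancel]
          field_simp
          ring
end

section
/- Let P ∈ ℝ^{N×N} be symmetric positive definite, ρ ∈ (0,1), σ ≥ 0, and let z^k, z^{k,⋆} ∈ ℝ^N (k ≥ 1) be sequences satisfying ‖z^{k+1} − z^{k,⋆}‖_P ≤ ρ·‖z^k − z^{k,⋆}‖_P for all k ≥ 1 and ‖z^{k,⋆} − z^{k−1,⋆}‖_P ≤ σ for all k ≥ 2. Then for all k ≥ 1, the Euclidean norm satisfies ‖z^{k+1} − z^{k,⋆}‖ ≤ √(cond(P))·ρ^k·‖z^1 − z^{1,⋆}‖ + σρ(1 − ρ^{k−1})/((1 − ρ)·√(λ_min(P))). -/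
open Matrix Finset

section SpectralBounds

variable {ι : Type*} [Fintype ι] [DecidableEq ι] {P : Matrix ι ι ℝ}

/-- The quadratic form of a symmetric matrix in its orthonormal eigenbasis. -/
lemma Matrix.IsHermitian.dotProduct_mulVec_eq_sum_eigenvalues (hP : P.IsHermitian) (v : ι → ℝ) :
    v ⬝ᵥ P *ᵥ v =
      ∑ i, hP.eigenvalues i * (v ᵥ* (hP.eigenvectorUnitary : Matrix ι ι ℝ)) i ^ 2 := by
  conv_lhs => rw [hP.spectral_theorem, Unitary.conjStarAlgAut_apply]
  rw [← mulVec_mulVec, ← mulVec_mulVec, dotProduct_mulVec, star_eq_conjTranspose,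
    conjTranspose_eq_transpose_of_trivial, mulVec_transpose]
  simp only [dotProduct, mulVec_diagonal, Function.comp_apply, RCLike.ofReal_real_eq_id, id_eq]
  exact Finset.sum_congr rfl fun i _ => by ring

/-- Orthogonal changes of basis preserve the dot product of a vector with itself. -/
lemma dotProduct_self_eq_sum_vecMul_sq (U : Matrix.unitaryGroup ι ℝ) (v : ι → ℝ) :
    v ⬝ᵥ v = ∑ i, (v ᵥ* (U : Matrix ι ι ℝ)) i ^ 2 := by
  have h : (U : Matrix ι ι ℝ) * (U : Matrix ι ι ℝ)ᵀ = 1 := by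
    simpa [star_eq_conjTranspose] using Unitary.coe_mul_star_self U
  calc v ⬝ᵥ v = v ⬝ᵥ ((U : Matrix ι ι ℝ) * (U : Matrix ι ι ℝ)ᵀ) *ᵥ v := by rw [h, one_mulVec]
    _ = _ := by
      rw [← mulVec_mulVec, dotProduct_mulVec, mulVec_transpose]
      simp only [dotProduct, sq]

lemma lamMin_mul_dotProduct_self_le (hP : P.IsHermitian) (v : ι → ℝ) :
    lamMin P hP * (v ⬝ᵥ v) ≤ v ⬝ᵥ P *ᵥ v := by
  rw [hP.dotProduct_mulVec_eq_sum_eigenvalues,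
    dotProduct_self_eq_sum_vecMul_sq hP.eigenvectorUnitary, Finset.mul_sum]
  exact Finset.sum_le_sum fun i _ => mul_le_mul_of_nonneg_right
    (ciInf_le (Set.finite_range _).bddBelow i) (sq_nonneg _)

lemma dotProduct_mulVec_le_lamMax_mul (hP : P.IsHermitian) (v : ι → ℝ) :
    v ⬝ᵥ P *ᵥ v ≤ lamMax P hP * (v ⬝ᵥ v) := by
  rw [hP.dotProduct_mulVec_eq_sum_eigenvalues,
    dotProduct_self_eq_sum_vecMul_sq hP.eigenvectorUnitary, Finset.mul_sum]
  exact Finset.sum_le_sum fun i _ => mul_le_mul_of_nonneg_right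
    (le_ciSup (Set.finite_range hP.eigenvalues).bddAbove i) (sq_nonneg _)

lemma lamMin_pos [Nonempty ι] (hP : P.PosDef) : 0 < lamMin P hP.1 := by
  obtain ⟨i, hi⟩ := exists_eq_ciInf_of_finite (f := hP.1.eigenvalues)
  exact (hP.eigenvalues_pos i).trans_eq hi

lemma lamMax_nonneg (hP : P.PosDef) : 0 ≤ lamMax P hP.1 :=
  Real.iSup_nonneg fun i => (hP.eigenvalues_pos i).le

lemma sqrt_lamMin_mul_vnorm_le_Pnorm [Nonempty ι] (hP : P.PosDef) (v : ι → ℝ) :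
    √(lamMin P hP.1) * vnorm v ≤ Pnorm P v := by
  rw [vnorm, Pnorm, ← Real.sqrt_mul (lamMin_pos hP).le]
  exact Real.sqrt_le_sqrt (lamMin_mul_dotProduct_self_le hP.1 v)

lemma Pnorm_le_sqrt_lamMax_mul_vnorm (hP : P.PosDef) (v : ι → ℝ) :
    Pnorm P v ≤ √(lamMax P hP.1) * vnorm v := by
  rw [vnorm, Pnorm, ← Real.sqrt_mul (lamMax_nonneg hP)]
  exact Real.sqrt_le_sqrt (dotProduct_mulVec_le_lamMax_mul hP.1 v)

lemma Pnorm_eq_norm_toLp (hP : P.PosDef) (v : ι → ℝ) :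
    Pnorm P v = ‖WithLp.toLp 2 fun i =>
      √(hP.1.eigenvalues i) * (v ᵥ* (hP.1.eigenvectorUnitary : Matrix ι ι ℝ)) i‖ := by
  rw [Pnorm, EuclideanSpace.norm_eq, hP.1.dotProduct_mulVec_eq_sum_eigenvalues]
  congr 1
  refine Finset.sum_congr rfl fun i _ => ?_
  rw [Real.norm_eq_abs, sq_abs, mul_pow, Real.sq_sqrt (hP.eigenvalues_pos i).le]

lemma Pnorm_add_le (hP : P.PosDef) (v w : ι → ℝ) :
    Pnorm P (v + w) ≤ Pnorm P v + Pnorm P w := by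
  simp only [Pnorm_eq_norm_toLp hP]
  refine le_of_eq_of_le (congrArg _ ?_) (norm_add_le _ _)
  ext i
  simp [add_vecMul, mul_add]

end SpectralBounds

/-- The tracking bound in the `P`-norm itself. -/
lemma Pnorm_tracking_bound {ι : Type*} [Fintype ι] [DecidableEq ι] {P : Matrix ι ι ℝ}
    (hP : P.PosDef) {ρ σ : ℝ} (hρ0 : 0 < ρ) (hρ1 : ρ < 1) {z zs : ℕ → ι → ℝ}
    (hcontract : ∀ k ≥ 1, Pnorm P (z (k + 1) - zs k) ≤ ρ * Pnorm P (z k - zs k))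
    (hvar : ∀ k ≥ 2, Pnorm P (zs (k - 1) - zs k) ≤ σ) :
    ∀ k ≥ 1, Pnorm P (z (k + 1) - zs k) ≤
      ρ ^ k * Pnorm P (z 1 - zs 1) + σ * ρ * (1 - ρ ^ (k - 1)) / (1 - ρ) := by
  intro k hk
  induction k, hk using Nat.le_induction with
  | base => simpa using hcontract 1 le_rfl
  | succ k hk ih =>
    obtain ⟨m, rfl⟩ := Nat.exists_eq_add_of_le' hk
    have hstep : Pnorm P (z (m + 1 + 1) - zs (m + 1 + 1)) ≤
        Pnorm P (z (m + 1 + 1) - zs (m + 1)) + σ := by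
      have h := Pnorm_add_le hP (z (m + 1 + 1) - zs (m + 1)) (zs (m + 1) - zs (m + 1 + 1))
      rw [sub_add_sub_cancel] at h
      exact h.trans (add_le_add_right (hvar (m + 1 + 1) (by omega)) _)
    have hne : 1 - ρ ≠ 0 := by linarith
    calc Pnorm P (z (m + 1 + 1 + 1) - zs (m + 1 + 1))
        ≤ ρ * Pnorm P (z (m + 1 + 1) - zs (m + 1 + 1)) := hcontract _ (by omega)
      _ ≤ ρ * (ρ ^ (m + 1) * Pnorm P (z 1 - zs 1)
            + σ * ρ * (1 - ρ ^ (m + 1 - 1)) / (1 - ρ) + σ) := by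
          gcongr
          linarith
      _ = _ := by
          simp only [Nat.add_sub_cancel]
          field_simp
          ring

lemma Pnorm_sub_comm {ι : Type*} [Fintype ι] (P : Matrix ι ι ℝ) (v w : ι → ℝ) :
    Pnorm P (v - w) = Pnorm P (w - v) := by
  rw [Pnorm, Pnorm, ← neg_sub w v, mulVec_neg, neg_dotProduct_neg]

/-- **Corollary 1.** Under the contraction and bounded-variation hypotheses, the Euclidean
norm satisfies `‖z^{k+1} - z^{k,⋆}‖ ≤ √(cond(P))·ρ^k·‖z^1 - z^{1,⋆}‖
+ σρ(1 - ρ^{k-1})/((1 - ρ)√(λ_min(P)))`. -/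
theorem tracking_bound_euclidean {N : ℕ}
    (P : Matrix (Fin N) (Fin N) ℝ) (hP : P.PosDef)
    (ρ σ : ℝ) (hρ0 : 0 < ρ) (hρ1 : ρ < 1) (hσ : 0 ≤ σ)
    (z zs : ℕ → Fin N → ℝ)
    (hcontract : ∀ k ≥ 1, Pnorm P (z (k + 1) - zs k) ≤ ρ * Pnorm P (z k - zs k))
    (hvar : ∀ k ≥ 2, Pnorm P (zs k - zs (k - 1)) ≤ σ) :
    ∀ k ≥ 1, vnorm (z (k + 1) - zs k) ≤
      Real.sqrt (lamMax P hP.1 / lamMin P hP.1) * ρ ^ k * vnorm (z 1 - zs 1)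
        + σ * ρ * (1 - ρ ^ (k - 1)) / ((1 - ρ) * Real.sqrt (lamMin P hP.1)) := by
  intro k hk
  rcases isEmpty_or_nonempty (Fin N) with _ | _
  · simp [vnorm, lamMin, Real.iInf_of_isEmpty]
  have hmin : 0 < √(lamMin P hP.1) := Real.sqrt_pos.2 (lamMin_pos hP)
  have hne : 1 - ρ ≠ 0 := by linarith
  have hP_bound := Pnorm_tracking_bound hP hρ0 hρ1 hcontract
    (fun k hk => (Pnorm_sub_comm P _ _).trans_le (hvar k hk)) k hk
  have hlow := sqrt_lamMin_mul_vnorm_le_Pnorm hP (z (k + 1) - zs k)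
  have hupp := mul_le_mul_of_nonneg_left (Pnorm_le_sqrt_lamMax_mul_vnorm hP (z 1 - zs 1))
    (pow_pos hρ0 k).le
  refine le_of_mul_le_mul_left ?_ hmin
  rw [Real.sqrt_div (lamMax_nonneg hP)]
  calc √(lamMin P hP.1) * vnorm (z (k + 1) - zs k)
      ≤ ρ ^ k * (√(lamMax P hP.1) * vnorm (z 1 - zs 1))
          + σ * ρ * (1 - ρ ^ (k - 1)) / (1 - ρ) := by linarith
    _ = _ := by
        field_simp
end

section
/- Let P ∈ ℝ^{N×N} be symmetric positive definite, ρ ∈ (0,1), and let z^k, z^{k,⋆} ∈ ℝ^N (k = 1,…,K) be sequences satisfying ‖z^{k+1} − z^{k,⋆}‖_P ≤ ρ·‖z^k − z^{k,⋆}‖_P for all 1 ≤ k ≤ K−1. Then Σ_{k=1}^K ‖z^k − z^{k,⋆}‖_P² ≤ ( 2·‖z^1 − z^{1,⋆}‖_P² + 4·W_{K,2} ) / (1 − ρ²)², where W_{K,2} := Σ_{k=2}^K ‖z^{k,⋆} − z^{k−1,⋆}‖_P². -/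
open Matrix Finset

lemma Pnorm_sq {ι : Type*} [Fintype ι] {P : Matrix ι ι ℝ} (hP : P.PosSemidef) (v : ι → ℝ) :
    Pnorm P v ^ 2 = v ⬝ᵥ P.mulVec v :=
  Real.sq_sqrt (by simpa using hP.dotProduct_mulVec_nonneg v)

/-- Young's inequality for the squared `P`-norm of a sum. -/
lemma Pnorm_add_sq_le {ι : Type*} [Fintype ι] {P : Matrix ι ι ℝ} (hP : P.PosSemidef)
    {ε : ℝ} (hε : 0 < ε) (u v : ι → ℝ) :
    Pnorm P (u + v) ^ 2 ≤ (1 + ε) * Pnorm P u ^ 2 + (1 + ε⁻¹) * Pnorm P v ^ 2 := by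
  have h : 0 ≤ (ε • u - v) ⬝ᵥ P.mulVec (ε • u - v) := by
    simpa using hP.dotProduct_mulVec_nonneg (ε • u - v)
  simp only [Pnorm_sq hP]
  simp only [mulVec_sub, mulVec_add, mulVec_smul, dotProduct_sub, sub_dotProduct, dotProduct_add,
    add_dotProduct, dotProduct_smul, smul_dotProduct, smul_eq_mul] at h ⊢
  have h' := mul_nonneg (inv_nonneg.mpr hε.le) h
  have hi : ε⁻¹ * ε = 1 := inv_mul_cancel₀ hε.ne'
  linear_combination h' + (ε * (u ⬝ᵥ P.mulVec u) - u ⬝ᵥ P.mulVec v - v ⬝ᵥ P.mulVec u) * hi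

/-- Summed form of the recursion `a (k + 1) ≤ q * a k + c * d (k + 1)`. -/
lemma sum_le_of_affine_recursion {q c : ℝ} (a d : ℕ → ℝ) (n : ℕ)
    (h : ∀ k, 1 ≤ k → k ≤ n → a (k + 1) ≤ q * a k + c * d (k + 1)) :
    (1 - q) * ∑ k ∈ Finset.Icc 1 (n + 1), a k + q * a (n + 1) ≤
      a 1 + c * ∑ k ∈ Finset.Icc 2 (n + 1), d k := by
  induction n with
  | zero => simp; linarith
  | succ n ih =>
    have hn := h (n + 1) (by omega) le_rfl
    have ih := ih fun k hk hkn => h k hk (by omega)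
    rw [Finset.sum_Icc_succ_top (show 1 ≤ n + 1 + 1 by omega),
      Finset.sum_Icc_succ_top (show 2 ≤ n + 1 + 1 by omega)]
    linarith

/-- **Lemma 4, second inequality (eq. (30)).** Under the contraction hypothesis,
`Σ_{k=1}^K ‖z^k - z^{k,⋆}‖_P² ≤ (2‖z^1 - z^{1,⋆}‖_P² + 4·W_{K,2})/(1 - ρ²)²`, with
`W_{K,2} = Σ_{k=2}^K ‖z^{k,⋆} - z^{k-1,⋆}‖_P²`. -/
theorem cumulative_squared_error_bound {N : ℕ}
    (P : Matrix (Fin N) (Fin N) ℝ) (hP : P.PosDef)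
    (ρ : ℝ) (hρ0 : 0 < ρ) (hρ1 : ρ < 1) (K : ℕ)
    (z zs : ℕ → Fin N → ℝ)
    (hcontract : ∀ k, 1 ≤ k → k ≤ K - 1 →
      Pnorm P (z (k + 1) - zs k) ≤ ρ * Pnorm P (z k - zs k)) :
    ∑ k ∈ Finset.Icc 1 K, (Pnorm P (z k - zs k)) ^ 2 ≤
      (2 * (Pnorm P (z 1 - zs 1)) ^ 2
        + 4 * ∑ k ∈ Finset.Icc 2 K, (Pnorm P (zs k - zs (k - 1))) ^ 2)
        / (1 - ρ ^ 2) ^ 2 := by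
  have hδ : 0 < 1 - ρ ^ 2 := by nlinarith
  have hρ2 : 0 < ρ ^ 2 := by positivity
  rcases K with _ | n
  · simp only [Finset.Icc_eq_empty_of_lt (show 0 < 1 by norm_num),
      Finset.Icc_eq_empty_of_lt (show 0 < 2 by norm_num), Finset.sum_empty]
    positivity
  have hε : 0 < (1 - ρ ^ 2) / (2 * ρ ^ 2) := by positivity
  have hrec : ∀ k, 1 ≤ k → k ≤ n →
      Pnorm P (z (k + 1) - zs (k + 1)) ^ 2 ≤ (1 + ρ ^ 2) / 2 * Pnorm P (z k - zs k) ^ 2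
        + (1 + ρ ^ 2) / (1 - ρ ^ 2) * Pnorm P (zs (k + 1) - zs (k + 1 - 1)) ^ 2 := by
    intro k hk hkn
    have hsq : Pnorm P (z (k + 1) - zs k) ^ 2 ≤ ρ ^ 2 * Pnorm P (z k - zs k) ^ 2 := by
      rw [← mul_pow]
      exact pow_le_pow_left₀ (Real.sqrt_nonneg _) (hcontract k hk (by omega)) 2
    have hneg : Pnorm P (zs k - zs (k + 1)) = Pnorm P (zs (k + 1) - zs k) := by
      rw [← neg_sub (zs (k + 1)) (zs k)]
      simp only [Pnorm, mulVec_neg, neg_dotProduct, dotProduct_neg, neg_neg]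
    have hY := Pnorm_add_sq_le hP.posSemidef hε (z (k + 1) - zs k) (zs k - zs (k + 1))
    rw [sub_add_sub_cancel, hneg] at hY
    rw [Nat.add_sub_cancel]
    have e1 : (1 + (1 - ρ ^ 2) / (2 * ρ ^ 2)) * ρ ^ 2 = (1 + ρ ^ 2) / 2 := by
      field_simp; ring
    have e2 : 1 + ((1 - ρ ^ 2) / (2 * ρ ^ 2))⁻¹ = (1 + ρ ^ 2) / (1 - ρ ^ 2) := by
      field_simp; ring
    have hm := mul_le_mul_of_nonneg_left hsq (add_pos one_pos hε).le
    rw [← mul_assoc, e1] at hm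
    rw [e2] at hY
    linarith
  have hsum := sum_le_of_affine_recursion (fun k => Pnorm P (z k - zs k) ^ 2)
    (fun k => Pnorm P (zs k - zs (k - 1)) ^ 2) n hrec
  set S := ∑ k ∈ Finset.Icc 1 (n + 1), Pnorm P (z k - zs k) ^ 2
  set W := ∑ k ∈ Finset.Icc 2 (n + 1), Pnorm P (zs k - zs (k - 1)) ^ 2
  have hW : 0 ≤ W := Finset.sum_nonneg fun _ _ => sq_nonneg _
  have ha := sq_nonneg (Pnorm P (z 1 - zs 1))
  have hlast : 0 ≤ (1 + ρ ^ 2) / 2 * Pnorm P (z (n + 1) - zs (n + 1)) ^ 2 := by positivity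
  have hS : (1 - ρ ^ 2) / 2 * S ≤
      Pnorm P (z 1 - zs 1) ^ 2 + (1 + ρ ^ 2) / (1 - ρ ^ 2) * W := by linarith
  have hc : (1 - ρ ^ 2) * ((1 + ρ ^ 2) / (1 - ρ ^ 2) * W) = (1 + ρ ^ 2) * W := by
    field_simp
  have hm := mul_le_mul_of_nonneg_left hS hδ.le
  rw [mul_add, hc] at hm
  rw [le_div_iff₀ (by positivity)]
  linarith [mul_nonneg hρ2.le ha, mul_nonneg hδ.le hW]
end
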